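/- arXiv:2402.08520 — 2 statements merged into one kernel-verified Lean document; each statement's English description precedes it below -/
import Mathlib

section
/- Let 0 < α < 1/2, let f : [0,1] → ℝ be α-Hölder, and let Φ : [0,1] → ℝ^d be α-bi-Hölder. For t ∈ ℝ^d let f_t(x) = f(x) + ⟨t, Φ(x)⟩ and let μ_t^{π/2} = (f_t)_* (L¹|[0,1]) be the distribution of values of f_t. Then for every ρ > 0 and every β with 1 < β and choice of N ∈ ℕ with β + 1 < N and αN < 1, the double integral ∫_{B(0,ρ)} ∫_ℝ |ξ|^β |\widehat{μ_t^{π/2}}(ξ)|² dξ dt is finite. -/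
open MeasureTheory Set ENNReal

lemma integrable_exp_neg_sum_sq {ι : Type*} [Fintype ι] :
    Integrable (fun t : ι → ℝ ↦ Real.exp (-∑ i, t i ^ 2)) := by
  have h : Integrable (fun t : ι → ℝ ↦ ∏ i, Real.exp (-1 * t i ^ 2)) :=
    Integrable.fintype_prod (f := fun _ x ↦ Real.exp (-1 * x ^ 2))
      fun _ ↦ integrable_exp_neg_mul_sq one_pos
  simpa [← Real.exp_sum] using h

lemma norm_integral_gaussian_mul_cexp {ι : Type*} [Fintype ι] (c : ι → ℝ) :
    ‖∫ t : ι → ℝ, (Real.exp (-∑ i, t i ^ 2) : ℂ) *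
        Complex.exp (Complex.I * ((∑ i, t i * c i : ℝ) : ℂ))‖
      = Real.pi ^ (Fintype.card ι / 2 : ℝ) * Real.exp (-(∑ i, c i ^ 2) / 4) := by
  have h := GaussianFourier.integral_cexp_neg_mul_sum_add (b := 1) (by simp)
    (fun i ↦ Complex.I * (c i : ℂ))
  have e : ∀ t : ι → ℝ, (Real.exp (-∑ i, t i ^ 2) : ℂ) *
        Complex.exp (Complex.I * ((∑ i, t i * c i : ℝ) : ℂ)) =
      Complex.exp (-1 * ∑ i, (t i : ℂ) ^ 2 + ∑ i, Complex.I * (c i : ℂ) * (t i : ℂ)) := by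
    intro t
    rw [Complex.ofReal_exp, ← Complex.exp_add]
    push_cast
    rw [Finset.mul_sum]
    congr 2
    · ring
    · exact Finset.sum_congr rfl fun i _ ↦ by ring
  simp_rw [e]
  rw [h, norm_mul, Complex.norm_exp, div_one, ← Complex.ofReal_natCast]
  congr 1
  · rw [Complex.norm_cpow_eq_rpow_re_of_pos Real.pi_pos]
    congr 1
    norm_num [Complex.div_re]
  · congr 1
    have : (∑ i, (Complex.I * (c i : ℂ)) ^ 2) / (4 * 1) = ((-(∑ i, c i ^ 2) / 4 : ℝ) : ℂ) := by
      simp [mul_pow]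
    rw [this, Complex.ofReal_re]

lemma norm_sq_le_sum_sq {ι : Type*} [Fintype ι] (v : ι → ℝ) : ‖v‖ ^ 2 ≤ ∑ i, v i ^ 2 := by
  have h0 : 0 ≤ ∑ i, v i ^ 2 := Finset.sum_nonneg fun i _ ↦ sq_nonneg _
  refine Real.le_sqrt (norm_nonneg v) h0 |>.1 ((pi_norm_le_iff_of_nonneg (Real.sqrt_nonneg _)).2 ?_)
  intro i
  refine Real.le_sqrt (norm_nonneg _) h0 |>.2 ?_
  rw [Real.norm_eq_abs, sq_abs]
  exact Finset.single_le_sum (f := fun i ↦ v i ^ 2) (fun i _ ↦ sq_nonneg _) (Finset.mem_univ i)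

/-- Averaging `|∫ e^{i(h + ⟨t, Ψ⟩)} dμ|²` against a Gaussian weight in `t` gives at most the
double integral of a Gaussian in `‖Ψ x - Ψ y‖`. -/
lemma lintegral_gaussian_mul_sq_norm_le {ι : Type*} [Fintype ι] (μ : Measure ℝ) [IsFiniteMeasure μ]
    {h : ℝ → ℝ} {Ψ : ℝ → ι → ℝ} (hh : Continuous h) (hΨ : Continuous Ψ) :
    ∫⁻ t : ι → ℝ, ENNReal.ofReal (Real.exp (-∑ i, t i ^ 2) *
        ‖∫ x, Complex.exp (Complex.I * ((h x + ∑ i, t i * Ψ x i : ℝ) : ℂ)) ∂μ‖ ^ 2)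
      ≤ ∫⁻ p, ENNReal.ofReal (Real.pi ^ (Fintype.card ι / 2 : ℝ) *
          Real.exp (-‖Ψ p.1 - Ψ p.2‖ ^ 2 / 4)) ∂(μ.prod μ) := by
  set G : (ι → ℝ) → ℝ × ℝ → ℂ := fun t p ↦ Complex.exp (Complex.I * ((h p.1 - h p.2 : ℝ) : ℂ)) *
    ((Real.exp (-∑ i, t i ^ 2) : ℂ) *
      Complex.exp (Complex.I * ((∑ i, t i * (Ψ p.1 - Ψ p.2) i : ℝ) : ℂ))) with hG
  have hGint : Integrable (Function.uncurry G) (volume.prod (μ.prod μ)) := by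
    have hdom : Integrable (fun z : (ι → ℝ) × (ℝ × ℝ) ↦ Real.exp (-∑ i, z.1 i ^ 2) * (1 : ℝ))
        (volume.prod (μ.prod μ)) :=
      integrable_exp_neg_sum_sq.mul_prod (integrable_const (1 : ℝ))
    refine hdom.mono' ?_ (Filter.Eventually.of_forall fun z ↦ ?_)
    · apply Continuous.aestronglyMeasurable
      simp only [hG, Function.uncurry_def]
      fun_prop
    · simp only [hG, Function.uncurry_def, norm_mul, mul_comm Complex.I,
        Complex.norm_exp_ofReal_mul_I, Complex.norm_real, Real.norm_eq_abs, Real.abs_exp]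
      simp
  have hsq : ∀ t : ι → ℝ, ∫ p, G t p ∂(μ.prod μ) = ((Real.exp (-∑ i, t i ^ 2) *
      ‖∫ x, Complex.exp (Complex.I * ((h x + ∑ i, t i * Ψ x i : ℝ) : ℂ)) ∂μ‖ ^ 2 : ℝ) : ℂ) := by
    intro t
    set φ : ℝ → ℂ := fun x ↦ Complex.exp (Complex.I * ((h x + ∑ i, t i * Ψ x i : ℝ) : ℂ)) with hφ
    have hGφ : ∀ p, G t p = (Real.exp (-∑ i, t i ^ 2) : ℂ) *
        (φ p.1 * (starRingEnd ℂ) (φ p.2)) := by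
      intro p
      simp only [hG, hφ, ← Complex.exp_conj, map_mul, Complex.conj_I, Complex.conj_ofReal]
      rw [mul_left_comm, ← Complex.exp_add, ← Complex.exp_add]
      congr 2
      push_cast [Pi.sub_apply, mul_sub, Finset.sum_sub_distrib]
      ring
    simp_rw [hGφ]
    rw [integral_const_mul, integral_prod_mul φ (fun y ↦ (starRingEnd ℂ) (φ y)), integral_conj,
      Complex.mul_conj, Complex.normSq_eq_norm_sq]
    push_cast
    rfl
  set R : (ι → ℝ) → ℝ := fun t ↦ Real.exp (-∑ i, t i ^ 2) *
      ‖∫ x, Complex.exp (Complex.I * ((h x + ∑ i, t i * Ψ x i : ℝ) : ℂ)) ∂μ‖ ^ 2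
  have hR0 : ∀ t, 0 ≤ R t := fun t ↦ by positivity
  have hRint : Integrable R := by
    have := hGint.integral_prod_left
    simp only [Function.uncurry_apply_pair, hsq] at this
    exact this.re
  rw [← ofReal_integral_eq_lintegral_ofReal hRint (Filter.Eventually.of_forall hR0)]
  have hRG : ((∫ t, R t : ℝ) : ℂ) = ∫ p, ∫ t, G t p ∂volume ∂(μ.prod μ) := by
    rw [← integral_integral_swap hGint]
    simp_rw [hsq]
    exact integral_ofReal.symm
  have hnorm : ENNReal.ofReal (∫ t, R t) = ‖((∫ t, R t : ℝ) : ℂ)‖ₑ := by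
    rw [← ofReal_norm, Complex.norm_real, Real.norm_of_nonneg (integral_nonneg hR0)]
  rw [hnorm, hRG]
  refine (enorm_integral_le_lintegral_enorm _).trans (lintegral_mono fun p ↦ ?_)
  rw [← ofReal_norm]
  refine ENNReal.ofReal_le_ofReal ?_
  simp only [hG]
  rw [integral_const_mul, norm_mul, norm_integral_gaussian_mul_cexp, mul_comm Complex.I,
    Complex.norm_exp_ofReal_mul_I, one_mul]
  gcongr
  exact norm_sq_le_sum_sq _

lemma lintegral_abs_rpow_lt_top {r : ℝ} (hr : -1 < r) :
    ∫⁻ x in Icc (-1 : ℝ) 1, ENNReal.ofReal (|x| ^ r) < ⊤ := by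
  have h1 : IntervalIntegrable (fun x : ℝ ↦ |x| ^ r) volume 0 1 :=
    (intervalIntegral.intervalIntegrable_rpow' hr).congr (fun x hx ↦ by
      rw [uIoc_of_le zero_le_one] at hx
      simp [abs_of_pos hx.1])
  have h2 : IntervalIntegrable (fun x : ℝ ↦ |x| ^ r) volume (-1) 0 := by
    rw [IntervalIntegrable.iff_comp_neg]
    simpa using h1.symm
  have h := h2.trans h1
  rw [intervalIntegrable_iff_integrableOn_Icc_of_le (by norm_num)] at h
  exact h.lintegral_lt_top

lemma lintegral_prod_abs_sub_rpow_lt_top {r : ℝ} (hr : -1 < r) :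
    ∫⁻ p, ENNReal.ofReal (|p.1 - p.2| ^ r)
      ∂((volume.restrict (Icc (0 : ℝ) 1)).prod (volume.restrict (Icc (0 : ℝ) 1))) < ⊤ := by
  rw [lintegral_prod _ (by fun_prop)]
  calc ∫⁻ x in Icc (0 : ℝ) 1, ∫⁻ y in Icc (0 : ℝ) 1, ENNReal.ofReal (|x - y| ^ r)
      ≤ ∫⁻ x in Icc (0 : ℝ) 1, ∫⁻ u in Icc (-1 : ℝ) 1, ENNReal.ofReal (|u| ^ r) := by
        refine setLIntegral_mono' measurableSet_Icc fun x hx ↦ ?_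
        rw [← lintegral_indicator measurableSet_Icc, ← lintegral_indicator measurableSet_Icc,
          ← lintegral_sub_left_eq_self
            ((Icc (-1 : ℝ) 1).indicator fun u ↦ ENNReal.ofReal (|u| ^ r)) x]
        refine lintegral_mono fun y ↦ ?_
        by_cases hy : y ∈ Icc (0 : ℝ) 1
        · have : x - y ∈ Icc (-1 : ℝ) 1 := ⟨by linarith [hx.1, hy.2], by linarith [hx.2, hy.1]⟩
          rw [indicator_of_mem this, indicator_of_mem hy]
        · rw [indicator_of_notMem hy]
          exact zero_le
    _ < ⊤ := by
        rw [lintegral_const]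
        exact ENNReal.mul_lt_top (lintegral_abs_rpow_lt_top hr) (by simp)

lemma one_add_pow_mul_exp_neg_sq_le (N : ℕ) {u : ℝ} (hu : 0 ≤ u) :
    (1 + u) ^ N * Real.exp (-u ^ 2 / 4) ≤ N.factorial * Real.exp 2 := by
  have h := Real.pow_div_factorial_le_exp (1 + u) (by linarith) N
  rw [div_le_iff₀ (by positivity)] at h
  calc (1 + u) ^ N * Real.exp (-u ^ 2 / 4)
      ≤ Real.exp (1 + u) * N.factorial * Real.exp (-u ^ 2 / 4) := by gcongr
    _ = N.factorial * Real.exp (1 + u + -u ^ 2 / 4) := by rw [Real.exp_add (1 + u)]; ring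
    _ ≤ _ := by
        gcongr
        nlinarith [sq_nonneg (u / 2 - 1)]

lemma exp_neg_sq_le_rpow_mul {N : ℕ} {α c v ξ u : ℝ} (hα : 0 < α) (hc : 0 < c)
    (hv : 0 < v) (hv1 : v ≤ 1) (hu : |ξ| * (c * v ^ α) ≤ u) :
    Real.exp (-u ^ 2 / 4) ≤ N.factorial * Real.exp 2 / (min 1 c) ^ N *
      (1 + |ξ|) ^ (-(N : ℝ)) * v ^ (-(α * N)) := by
  have hva : 0 < v ^ α := Real.rpow_pos_of_pos hv _
  have hva1 : v ^ α ≤ 1 := Real.rpow_le_one hv.le hv1 hα.le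
  have hm : 0 < min 1 c := lt_min one_pos hc
  have hle : min 1 c * (1 + |ξ|) * v ^ α ≤ 1 + u := by
    have h1 : min 1 c * v ^ α ≤ 1 := mul_le_one₀ (min_le_left _ _) hva.le hva1
    have h2 : |ξ| * (min 1 c * v ^ α) ≤ |ξ| * (c * v ^ α) := by
      gcongr; exact min_le_right _ _
    nlinarith
  have hu0 : 0 ≤ u := le_trans (by positivity) hu
  have hb := one_add_pow_mul_exp_neg_sq_le N hu0
  have hp : 0 < (min 1 c * (1 + |ξ|) * v ^ α) ^ N := by positivity
  have h3 : (min 1 c * (1 + |ξ|) * v ^ α) ^ N * Real.exp (-u ^ 2 / 4)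
      ≤ N.factorial * Real.exp 2 := le_trans (by gcongr) hb
  rw [mul_comm, ← le_div_iff₀ hp] at h3
  refine h3.trans_eq ?_
  rw [Real.rpow_neg (by positivity), Real.rpow_neg hv.le, Real.rpow_natCast,
    Real.rpow_mul_natCast hv.le, mul_pow, mul_pow]
  field_simp

lemma continuous_IccExtend_of_dist_le_rpow {E : Type*} [SeminormedAddCommGroup E] {g : ℝ → E}
    {α C : ℝ} (hα : 0 < α)
    (hg : ∀ x ∈ Icc (0 : ℝ) 1, ∀ y ∈ Icc (0 : ℝ) 1, ‖g x - g y‖ ≤ C * |x - y| ^ α) :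
    Continuous (IccExtend zero_le_one ((Icc (0 : ℝ) 1).domRestrict g)) := by
  refine Continuous.Icc_extend' (continuous_iff_continuousAt.2 fun x ↦ ?_)
  refine tendsto_iff_norm_sub_tendsto_zero.2 (squeeze_zero (fun _ ↦ norm_nonneg _)
    (fun y ↦ hg y y.2 x x.2) ?_)
  have : Continuous fun y : Icc (0 : ℝ) 1 ↦ C * |(y : ℝ) - x| ^ α :=
    continuous_const.mul ((by fun_prop : Continuous fun y : Icc (0 : ℝ) 1 ↦ |(y : ℝ) - x|).rpow_const
      fun _ ↦ Or.inr hα.le)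
  simpa [Real.zero_rpow hα.ne'] using this.tendsto x

/-- The Gaussian average over `t` of `|\widehat{μ_t}(ξ)|²` decays like `|ξ|^{-N}`. -/
lemma lintegral_gaussian_mul_sq_norm_fourier_le {ι : Type*} [Fintype ι] {f : ℝ → ℝ}
    {Φ : ℝ → ι → ℝ} (hf : Continuous f) (hΦ : Continuous Φ) {α c : ℝ} (hα : 0 < α) (hc : 0 < c)
    (hlow : ∀ x ∈ Icc (0 : ℝ) 1, ∀ y ∈ Icc (0 : ℝ) 1, c * |x - y| ^ α ≤ ‖Φ x - Φ y‖)
    (N : ℕ) (hαN : α * N < 1) :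
    ∃ K : ℝ≥0∞, K < ⊤ ∧ ∀ ξ : ℝ, ∫⁻ t : ι → ℝ, ENNReal.ofReal (Real.exp (-∑ i, t i ^ 2) *
        ‖∫ x in Icc (0 : ℝ) 1,
          Complex.exp (Complex.I * ((ξ * f x + ∑ i, t i * (ξ * Φ x i) : ℝ) : ℂ))‖ ^ 2)
      ≤ K * ENNReal.ofReal ((1 + |ξ|) ^ (-(N : ℝ))) := by
  set μ := volume.restrict (Icc (0 : ℝ) 1)
  set A : ℝ := Real.pi ^ (Fintype.card ι / 2 : ℝ) * (N.factorial * Real.exp 2 / (min 1 c) ^ N)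
  have hm : 0 < min 1 c := lt_min one_pos hc
  have hA : 0 ≤ A := by positivity
  refine ⟨ENNReal.ofReal A * ∫⁻ p, ENNReal.ofReal (|p.1 - p.2| ^ (-(α * N))) ∂(μ.prod μ),
    ENNReal.mul_lt_top ofReal_lt_top (lintegral_prod_abs_sub_rpow_lt_top (by linarith)),
    fun ξ ↦ ?_⟩
  refine (lintegral_gaussian_mul_sq_norm_le μ (h := fun x ↦ ξ * f x) (Ψ := fun x i ↦ ξ * Φ x i)
    (by fun_prop) (by fun_prop)).trans ?_
  have hne : ∀ᵐ p ∂(μ.prod μ), p.1 ≠ p.2 := by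
    refine (Measure.ae_prod_iff_ae_ae ?_).2 (Filter.Eventually.of_forall fun x ↦ ?_)
    · exact (measurableSet_eq_fun measurable_fst measurable_snd).compl
    · have : ∀ᵐ y ∂μ, y ≠ x := ae_restrict_of_ae (Measure.ae_ne volume x)
      filter_upwards [this] with y hy using hy.symm
  have hmem : ∀ᵐ p ∂(μ.prod μ), p ∈ Icc (0 : ℝ) 1 ×ˢ Icc (0 : ℝ) 1 := by
    rw [Measure.prod_restrict]
    exact ae_restrict_mem (measurableSet_Icc.prod measurableSet_Icc)
  calc _ ≤ ∫⁻ p, ENNReal.ofReal (A * (1 + |ξ|) ^ (-(N : ℝ))) *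
        ENNReal.ofReal (|p.1 - p.2| ^ (-(α * N))) ∂(μ.prod μ) := by
        refine lintegral_mono_ae ?_
        filter_upwards [hne, hmem] with p hp hpm
        rw [← ENNReal.ofReal_mul (by positivity)]
        refine ENNReal.ofReal_le_ofReal ?_
        have hv1 : |p.1 - p.2| ≤ 1 :=
          abs_le.2 ⟨by linarith [hpm.1.1, hpm.2.2], by linarith [hpm.1.2, hpm.2.1]⟩
        have hu : |ξ| * (c * |p.1 - p.2| ^ α) ≤
            ‖(fun i ↦ ξ * Φ p.1 i) - (fun i ↦ ξ * Φ p.2 i)‖ := by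
          have : (fun i ↦ ξ * Φ p.1 i) - (fun i ↦ ξ * Φ p.2 i) = ξ • (Φ p.1 - Φ p.2) := by
            ext i; simp [mul_sub]
          rw [this, norm_smul, Real.norm_eq_abs]
          exact mul_le_mul_of_nonneg_left (hlow _ hpm.1 _ hpm.2) (abs_nonneg _)
        have := exp_neg_sq_le_rpow_mul (N := N) hα hc (abs_pos.2 (sub_ne_zero.2 hp)) hv1 hu
        calc _ ≤ _ := mul_le_mul_of_nonneg_left this (by positivity)
          _ = _ := by ring
    _ = _ := by
        rw [lintegral_const_mul' _ _ ofReal_ne_top, ENNReal.ofReal_mul hA]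
        ring

lemma lintegral_abs_rpow_mul_one_add_abs_rpow_lt_top {β N : ℝ} (hβ : 0 ≤ β) (hN : β + 1 < N) :
    ∫⁻ ξ : ℝ, ENNReal.ofReal (|ξ| ^ β * (1 + |ξ|) ^ (-N)) < ⊤ := by
  have h : Integrable fun ξ : ℝ ↦ (1 + ‖ξ‖) ^ (-(N - β)) :=
    integrable_one_add_norm (by simp; linarith)
  refine lt_of_le_of_lt (lintegral_mono fun ξ ↦ ENNReal.ofReal_le_ofReal ?_) h.lintegral_lt_top
  rw [Real.norm_eq_abs, neg_sub, sub_eq_add_neg, Real.rpow_add (by positivity)]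
  gcongr
  linarith

theorem stmt_14 (α C : ℝ) (hα : 0 < α) (hα2 : α < 1/2) (hC : 0 < C)
    (f : ℝ → ℝ) (hf : ∀ x ∈ Icc (0:ℝ) 1, ∀ z ∈ Icc (0:ℝ) 1, |f x - f z| ≤ C * |x - z| ^ α)
    (d : ℕ) (Φ : ℝ → (Fin d → ℝ)) (c₁ c₂ : ℝ) (hc₁ : 0 < c₁) (hc₂ : 0 < c₂)
    (hΦ : ∀ x ∈ Icc (0:ℝ) 1, ∀ y ∈ Icc (0:ℝ) 1,
      c₁ * |x - y| ^ α ≤ ‖Φ x - Φ y‖ ∧ ‖Φ x - Φ y‖ ≤ c₂ * |x - y| ^ α)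
    (ρ : ℝ) (hρ : 0 < ρ) (β : ℝ) (hβ : 1 < β) (N : ℕ)
    (hN : β + 1 < N) (hαN : α * N < 1) :
    ∫⁻ t in Metric.ball (0 : Fin d → ℝ) ρ,
        ∫⁻ ξ : ℝ, ENNReal.ofReal (|ξ| ^ β *
          ‖∫ x in Icc (0:ℝ) 1,
              Complex.exp (Complex.I * ξ * (f x + ∑ i, t i * Φ x i))‖ ^ 2)
          ∂volume ∂volume ≠ ⊤ := by
  set f' : ℝ → ℝ := IccExtend zero_le_one ((Icc (0 : ℝ) 1).domRestrict f)
  set Φ' : ℝ → Fin d → ℝ := IccExtend zero_le_one ((Icc (0 : ℝ) 1).domRestrict Φ)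
  have hf'c : Continuous f' := continuous_IccExtend_of_dist_le_rpow hα hf
  have hΦ'c : Continuous Φ' :=
    continuous_IccExtend_of_dist_le_rpow hα fun x hx y hy ↦ (hΦ x hx y hy).2
  have hf' : ∀ x ∈ Icc (0 : ℝ) 1, f' x = f x := fun x hx ↦ IccExtend_of_mem _ _ hx
  have hΦ' : ∀ x ∈ Icc (0 : ℝ) 1, Φ' x = Φ x := fun x hx ↦ IccExtend_of_mem _ _ hx
  obtain ⟨K, hK, hbound⟩ := lintegral_gaussian_mul_sq_norm_fourier_le hf'c hΦ'c hα hc₁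
    (fun x hx y hy ↦ by rw [hΦ' x hx, hΦ' y hy]; exact (hΦ x hx y hy).1) N hαN
  set F : (Fin d → ℝ) → ℝ → ℂ := fun t ξ ↦ ∫ x in Icc (0 : ℝ) 1,
    Complex.exp (Complex.I * ((ξ * f' x + ∑ i, t i * (ξ * Φ' x i) : ℝ) : ℂ))
  have hFeq : ∀ t (ξ : ℝ), ∫ x in Icc (0:ℝ) 1,
      Complex.exp (Complex.I * ξ * (f x + ∑ i, t i * Φ x i)) = F t ξ := by
    intro t ξ
    refine setIntegral_congr_fun measurableSet_Icc fun x hx ↦ ?_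
    simp only [hf' x hx, hΦ' x hx]
    push_cast
    rw [mul_assoc, mul_add, Finset.mul_sum]
    simp_rw [mul_left_comm]
  have hFm : Measurable (Function.uncurry F) := by
    refine (StronglyMeasurable.integral_prod_right (E := ℂ) (f := fun (z : (Fin d → ℝ) × ℝ) x ↦
      Complex.exp (Complex.I * ((z.2 * f' x + ∑ i, z.1 i * (z.2 * Φ' x i) : ℝ) : ℂ)))
      (Continuous.stronglyMeasurable ?_)).measurable
    simp only [Function.uncurry_def]
    fun_prop
  simp_rw [hFeq]
  set E : ℝ := Real.exp (d * ρ ^ 2) with hE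
  set w : (Fin d → ℝ) → ℝ := fun t ↦ Real.exp (-∑ i, t i ^ 2) with hw
  have hwE : ∀ t ∈ Metric.ball (0 : Fin d → ℝ) ρ, 1 ≤ E * w t := by
    intro t ht
    rw [hE, hw, ← Real.exp_add]
    refine Real.one_le_exp ?_
    have : ∑ i, t i ^ 2 ≤ ∑ _i : Fin d, ρ ^ 2 := by
      refine Finset.sum_le_sum fun i _ ↦ sq_le_sq' ?_ ?_ <;>
      · have := (norm_le_pi_norm t i).trans (mem_ball_zero_iff.1 ht).le
        have := abs_le.1 this
        linarith
    simp at this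
    linarith
  have hmain : ∫⁻ t in Metric.ball (0 : Fin d → ℝ) ρ,
      ∫⁻ ξ : ℝ, ENNReal.ofReal (|ξ| ^ β * ‖F t ξ‖ ^ 2) ≤
      ENNReal.ofReal E * K * ∫⁻ ξ : ℝ, ENNReal.ofReal (|ξ| ^ β * (1 + |ξ|) ^ (-(N : ℝ))) := by
    calc _ ≤ ∫⁻ t in Metric.ball (0 : Fin d → ℝ) ρ, ∫⁻ ξ : ℝ,
          ENNReal.ofReal (E * |ξ| ^ β) * ENNReal.ofReal (w t * ‖F t ξ‖ ^ 2) := by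
          refine setLIntegral_mono' measurableSet_ball fun t ht ↦ lintegral_mono fun ξ ↦ ?_
          rw [← ENNReal.ofReal_mul (by positivity)]
          refine ENNReal.ofReal_le_ofReal ?_
          have : 0 ≤ |ξ| ^ β * ‖F t ξ‖ ^ 2 := by positivity
          nlinarith [hwE t ht]
      _ ≤ ∫⁻ t : Fin d → ℝ, ∫⁻ ξ : ℝ,
          ENNReal.ofReal (E * |ξ| ^ β) * ENNReal.ofReal (w t * ‖F t ξ‖ ^ 2) :=
          setLIntegral_le_lintegral _ _
      _ = ∫⁻ ξ : ℝ, ENNReal.ofReal (E * |ξ| ^ β) *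
          ∫⁻ t : Fin d → ℝ, ENNReal.ofReal (w t * ‖F t ξ‖ ^ 2) := by
          rw [lintegral_lintegral_swap]
          · simp_rw [lintegral_const_mul' _ _ ofReal_ne_top]
          · have hFm' : Measurable fun z : (Fin d → ℝ) × ℝ ↦ F z.1 z.2 := hFm
            simp only [Function.uncurry_def, hw]
            fun_prop
      _ ≤ ∫⁻ ξ : ℝ, ENNReal.ofReal (E * |ξ| ^ β) *
          (K * ENNReal.ofReal ((1 + |ξ|) ^ (-(N : ℝ)))) :=
          lintegral_mono fun ξ ↦ mul_le_mul_right (hbound ξ) _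
      _ = _ := by
          rw [← lintegral_const_mul' _ _ (ENNReal.mul_lt_top ofReal_lt_top hK).ne]
          refine lintegral_congr fun ξ ↦ ?_
          rw [ENNReal.ofReal_mul (by positivity), ENNReal.ofReal_mul (by positivity)]
          ring
  exact (hmain.trans_lt (ENNReal.mul_lt_top (ENNReal.mul_lt_top ofReal_lt_top hK)
    (lintegral_abs_rpow_mul_one_add_abs_rpow_lt_top (by linarith) hN))).ne
end

section
/- Let 0 < α < 1/2, let f : [0,1] → ℝ be α-Hölder, and let Φ : [0,1] → ℝ^d be α-bi-Hölder. Then for Lebesgue-almost every t ∈ ℝ^d, the function f_t(x) = f(x) + ⟨t, Φ(x)⟩ satisfies: for every y ∈ ℝ, the upper Minkowski dimension of f_t⁻¹({y}) is at most 1 - α. -/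
open MeasureTheory Set Filter

/-- The maximal number of points of `A` that are centers of pairwise disjoint
open `r`-balls (the packing number). -/
noncomputable def packingNum {X : Type*} [MetricSpace X] (A : Set X) (r : ℝ) : ℕ :=
  sSup {n : ℕ | ∃ s : Finset X, ↑s ⊆ A ∧ s.card = n ∧
    (s : Set X).PairwiseDisjoint (fun x => Metric.ball x r)}

/-- Upper Minkowski (box) dimension defined via packings. -/
noncomputable def upperMinkowski {X : Type*} [MetricSpace X] (A : Set X) : ℝ :=
  limsup (fun r : ℝ => Real.log (packingNum A r) / (-Real.log r)) (nhdsWithin 0 (Ioi 0))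

/-- Lower local (pointwise) dimension of a measure at a point, as an extended real,
with the convention that it is `+∞` if small balls have measure zero. -/
noncomputable def lowerLocalDim (μ : Measure ℝ) (y : ℝ) : EReal :=
  liminf (fun r : ℝ => ENNReal.log (μ (Metric.ball y r)) / (Real.log r : EReal))
    (nhdsWithin 0 (Ioi 0))


/-- A uniform power bound on the packing numbers at small scales bounds the upper Minkowski
dimension. -/
lemma upperMinkowski_le_of_packingNum_le {X : Type*} [MetricSpace X] {A : Set X} {K β : ℝ}
    (hK : 1 ≤ K) (hβ : 0 ≤ β)
    (h : ∀ r : ℝ, 0 < r → r ≤ 1 / 2 → (packingNum A r : ℝ) ≤ K * r ^ (-β)) :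
    upperMinkowski A ≤ β := by
  have hlog : Tendsto (fun r : ℝ => -Real.log r) (nhdsWithin 0 (Ioi 0)) atTop :=
    tendsto_neg_atBot_atTop.comp Real.tendsto_log_nhdsGT_zero
  have hlim : Tendsto (fun r : ℝ => Real.log K / (-Real.log r) + β) (nhdsWithin 0 (Ioi 0))
      (nhds β) := by
    simpa using (hlog.const_div_atTop (Real.log K)).add_const β
  have hsmall : ∀ᶠ r : ℝ in nhdsWithin 0 (Ioi 0), 0 < r ∧ r ≤ 1 / 2 := by
    filter_upwards [Ioc_mem_nhdsGT (show (0 : ℝ) < 1 / 2 by norm_num)] with r hr using hr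
  rw [upperMinkowski, ← hlim.limsup_eq]
  refine limsup_le_limsup ?_ ?_ hlim.isBoundedUnder_le
  · filter_upwards [hsmall] with r hr
    have hl : 0 < -Real.log r := by
      have := Real.log_neg hr.1 (by linarith [hr.2])
      linarith
    have hr1 : 1 ≤ r ^ (-β) :=
      Real.one_le_rpow_of_pos_of_le_one_of_nonpos hr.1 (by linarith [hr.2]) (by linarith)
    have hKr : 1 ≤ K * r ^ (-β) := one_le_mul_of_one_le_of_one_le hK hr1
    have key : Real.log (packingNum A r) ≤ Real.log K + β * (-Real.log r) := by
      have : Real.log (K * r ^ (-β)) = Real.log K + β * (-Real.log r) := by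
        rw [Real.log_mul (by linarith) (by linarith), Real.log_rpow hr.1]; ring
      rw [← this]
      rcases Nat.eq_zero_or_pos (packingNum A r) with h0 | h0
      · rw [h0]; simpa using Real.log_nonneg hKr
      · exact Real.log_le_log (by exact_mod_cast h0) (h r hr.1 hr.2)
    calc Real.log (packingNum A r) / (-Real.log r)
        ≤ (Real.log K + β * (-Real.log r)) / (-Real.log r) := by gcongr
      _ = Real.log K / (-Real.log r) + β := by rw [add_div, mul_div_cancel_right₀ _ hl.ne']
  · refine IsCoboundedUnder.of_frequently_ge (a := 0) (Eventually.frequently ?_)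
    filter_upwards [hsmall] with r hr
    have hl : 0 < -Real.log r := by
      have := Real.log_neg hr.1 (by linarith [hr.2])
      linarith
    exact div_nonneg (Real.log_natCast_nonneg _) hl.le

/-- If every sublevel set `{|g - y| ≤ ρ}` of a Hölder function has measure `O(ρ)`, then the
packing numbers of the level set `{g = y}` are `O(r ^ (α - 1))`. -/
lemma packingNum_levelSet_le {g : ℝ → ℝ} {α L M y r : ℝ} (hα : 0 < α) (hL : 0 < L)
    (hg : ∀ x ∈ Icc (0 : ℝ) 1, ∀ z ∈ Icc (0 : ℝ) 1, |g x - g z| ≤ L * |x - z| ^ α)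
    (hM : ∀ ρ > 0, volume.real (Icc (0 : ℝ) 1 ∩ {x | |g x - y| ≤ ρ}) ≤ M * ρ)
    (hr : 0 < r) (hr2 : r ≤ 1 / 2) :
    (packingNum (g ⁻¹' {y} ∩ Icc (0 : ℝ) 1) r : ℝ) ≤ M * L * r ^ (-(1 - α)) := by
  have key : ∀ s : Finset ℝ, ↑s ⊆ g ⁻¹' {y} ∩ Icc (0 : ℝ) 1 →
      (s : Set ℝ).PairwiseDisjoint (fun x => Metric.ball x r) →
      (s.card : ℝ) ≤ M * L * r ^ (-(1 - α)) := by
    intro s hs hd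
    have hsub : (⋃ x ∈ s, (Metric.ball x r ∩ Icc (0 : ℝ) 1)) ⊆
        Icc (0 : ℝ) 1 ∩ {x | |g x - y| ≤ L * r ^ α} := by
      intro z hz
      simp only [mem_iUnion] at hz
      obtain ⟨x, hx, hzx, hz1⟩ := hz
      refine ⟨hz1, ?_⟩
      obtain ⟨hxy, hx1⟩ := hs hx
      have hxy : g x = y := hxy
      rw [mem_ofPred_eq, ← hxy]
      refine (hg z hz1 x hx1).trans ?_
      rw [Metric.mem_ball, Real.dist_eq] at hzx
      gcongr
    have hball : ∀ x ∈ s, r ≤ volume.real (Metric.ball x r ∩ Icc (0 : ℝ) 1) := by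
      intro x hx
      obtain ⟨-, hx1⟩ := hs hx
      have hfin : volume (Metric.ball x r ∩ Icc (0 : ℝ) 1) ≠ ⊤ :=
        measure_ne_top_of_subset inter_subset_left measure_ball_lt_top.ne
      rcases le_total x (1 / 2) with hx2 | hx2
      · calc r = volume.real (Ico x (x + r)) := by simp [hr.le]
          _ ≤ _ := measureReal_mono (fun z hz => by
            rw [Real.ball_eq_Ioo]
            exact ⟨⟨by linarith [hz.1], hz.2⟩, by linarith [hz.1, hx1.1], by linarith [hz.2]⟩)
            hfin
      · calc r = volume.real (Ioc (x - r) x) := by simp [hr.le]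
          _ ≤ _ := measureReal_mono (fun z hz => by
            rw [Real.ball_eq_Ioo]
            exact ⟨⟨hz.1, by linarith [hz.2]⟩, by linarith [hz.1], by linarith [hz.2, hx1.2]⟩)
            hfin
    have hcard : s.card * r ≤ M * (L * r ^ α) := by
      calc s.card * r = ∑ x ∈ s, r := by simp
        _ ≤ ∑ x ∈ s, volume.real (Metric.ball x r ∩ Icc (0 : ℝ) 1) := Finset.sum_le_sum hball
        _ = volume.real (⋃ x ∈ s, (Metric.ball x r ∩ Icc (0 : ℝ) 1)) :=
          (measureReal_biUnion_finset (hd.mono fun x => inter_subset_left)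
            (fun x _ => measurableSet_ball.inter measurableSet_Icc)
            (fun x _ => measure_ne_top_of_subset inter_subset_left measure_ball_lt_top.ne)).symm
        _ ≤ volume.real (Icc (0 : ℝ) 1 ∩ {x | |g x - y| ≤ L * r ^ α}) :=
          measureReal_mono hsub (measure_ne_top_of_subset inter_subset_left (by simp))
        _ ≤ M * (L * r ^ α) := hM _ (by positivity)
    have : r ^ (-(1 - α)) = r ^ α / r := by
      rw [neg_sub, Real.rpow_sub hr, Real.rpow_one]
    rw [this, ← mul_div_assoc, le_div_iff₀ hr]
    linarith
  have h0 : 0 ≤ M * L * r ^ (-(1 - α)) := by simpa using key ∅ (by simp) (by simp)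
  rw [← Nat.le_floor_iff h0]
  refine csSup_le' ?_
  rintro n ⟨s, hs, rfl, hd⟩
  exact Nat.le_floor (key s hs hd)

lemma continuousOn_of_norm_sub_le_rpow {E : Type*} [SeminormedAddCommGroup E] {f : ℝ → E}
    {s : Set ℝ} {C α : ℝ} (hα : 0 < α)
    (hf : ∀ x ∈ s, ∀ z ∈ s, ‖f x - f z‖ ≤ C * |x - z| ^ α) : ContinuousOn f s := by
  intro z hz
  rw [ContinuousWithinAt, tendsto_iff_norm_sub_tendsto_zero]
  have h : Tendsto (fun x : ℝ => C * |x - z| ^ α) (nhdsWithin z s) (nhds 0) := by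
    have hc : Continuous fun x : ℝ => C * |x - z| ^ α :=
      continuous_const.mul ((continuous_id.sub continuous_const).abs.rpow_const
        fun _ => Or.inr hα.le)
    have := (hc.tendsto z).mono_left (nhdsWithin_le_nhds (s := s))
    simpa [Real.zero_rpow hα.ne'] using this
  refine squeeze_zero' (Eventually.of_forall fun _ => norm_nonneg _) ?_ h
  filter_upwards [self_mem_nhdsWithin] with x hx using hf x hx z hz

/-- If the Fourier transform of the occupation measure of `g` is integrable, then the occupation
measure has linearly bounded mass on small intervals. -/
lemma exists_measureReal_sublevel_le {g : ℝ → ℝ} (hg : Continuous g)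
    (hG : Integrable fun ξ : ℝ => ∫ x in Icc (0 : ℝ) 1, Complex.exp (Complex.I * ξ * g x)) :
    ∃ M : ℝ, ∀ y : ℝ, ∀ ρ > 0,
      volume.real (Icc (0 : ℝ) 1 ∩ {x | |g x - y| ≤ ρ}) ≤ M * ρ := by
  set G : ℝ → ℂ := fun ξ => ∫ x in Icc (0 : ℝ) 1, Complex.exp (Complex.I * ξ * g x) with hGdef
  refine ⟨Real.exp (1 / 4) * (∫ ξ, ‖G ξ‖) / √Real.pi, fun y ρ hρ => ?_⟩
  set c : ℝ := √Real.pi / ρ with hc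
  have hc0 : 0 < c := by positivity
  have hgauss : ∀ u : ℝ, ∫ ξ : ℝ, Complex.exp (Complex.I * u * ξ) *
      Complex.exp (-(ρ ^ 2 : ℝ) * (ξ : ℂ) ^ 2) = ((c * Real.exp (-u ^ 2 / (4 * ρ ^ 2)) : ℝ) : ℂ) := by
    intro u
    rw [fourierIntegral_gaussian (b := ((ρ ^ 2 : ℝ) : ℂ)) (by rw [Complex.ofReal_re]; positivity)]
    have h1 : ((Real.pi : ℂ) / ((ρ ^ 2 : ℝ) : ℂ)) ^ (1 / 2 : ℂ) = (c : ℂ) := by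
      rw [hc, ← Complex.ofReal_div, show (1 / 2 : ℂ) = ((1 / 2 : ℝ) : ℂ) by norm_num,
        ← Complex.ofReal_cpow (by positivity), ← Real.sqrt_eq_rpow, Real.sqrt_div Real.pi_pos.le,
        Real.sqrt_sq hρ.le]
    rw [h1]
    push_cast
    rfl
  have hswap : ∫ x in Icc (0 : ℝ) 1, c * Real.exp (-(g x - y) ^ 2 / (4 * ρ ^ 2)) ≤
      ∫ ξ, ‖G ξ‖ := by
    have hint : Integrable (Function.uncurry fun (x ξ : ℝ) =>
        Complex.exp (Complex.I * (g x - y : ℝ) * ξ) * Complex.exp (-(ρ ^ 2 : ℝ) * (ξ : ℂ) ^ 2))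
        ((volume.restrict (Icc (0 : ℝ) 1)).prod volume) := by
      have h1 : Integrable (fun ξ : ℝ => Real.exp (-ρ ^ 2 * ξ ^ 2)) :=
        integrable_exp_neg_mul_sq (by positivity)
      refine (h1.comp_snd (volume.restrict (Icc (0 : ℝ) 1))).mono' ?_ ?_
      · exact (by fun_prop : Continuous _).aestronglyMeasurable
      · refine Eventually.of_forall fun z => ?_
        simp only [Function.uncurry, norm_mul, Complex.norm_exp]
        simp [← Complex.ofReal_pow]
    have hre : ((∫ x in Icc (0 : ℝ) 1, c * Real.exp (-(g x - y) ^ 2 / (4 * ρ ^ 2)) : ℝ) : ℂ) =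
        ∫ ξ : ℝ, Complex.exp (-(ρ ^ 2 : ℝ) * (ξ : ℂ) ^ 2) * Complex.exp (-(Complex.I * ξ * y)) *
          G ξ := by
      rw [← integral_complex_ofReal]
      simp_rw [← hgauss]
      rw [integral_integral_swap hint]
      refine integral_congr_ae (Eventually.of_forall fun ξ => ?_)
      simp only [hGdef]
      rw [← integral_const_mul]
      refine integral_congr_ae (Eventually.of_forall fun x => ?_)
      simp only [← Complex.exp_add]
      congr 1
      push_cast
      ring
    calc _ ≤ ‖((∫ x in Icc (0 : ℝ) 1,
          c * Real.exp (-(g x - y) ^ 2 / (4 * ρ ^ 2)) : ℝ) : ℂ)‖ := by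
          rw [Complex.norm_real]; exact le_abs_self _
      _ ≤ ∫ ξ, ‖G ξ‖ := by
        rw [hre]
        refine norm_integral_le_of_norm_le hG.norm (Eventually.of_forall fun ξ => ?_)
        rw [norm_mul, norm_mul, Complex.norm_exp, Complex.norm_exp]
        refine mul_le_of_le_one_left (norm_nonneg _) ?_
        rw [← Real.exp_add, Real.exp_le_one_iff]
        simp only [← Complex.ofReal_pow, ← Complex.ofReal_neg, ← Complex.ofReal_mul,
          Complex.ofReal_re]
        simp
        positivity
  set S : Set ℝ := Icc (0 : ℝ) 1 ∩ {x | |g x - y| ≤ ρ} with hS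
  have hSm : MeasurableSet S := measurableSet_Icc.inter
    (measurableSet_le (by fun_prop) measurable_const)
  have hcont : Continuous fun x => c * Real.exp (-(g x - y) ^ 2 / (4 * ρ ^ 2)) := by fun_prop
  have hlow : volume.real S * (c * Real.exp (-(1 / 4))) ≤
      ∫ x in Icc (0 : ℝ) 1, c * Real.exp (-(g x - y) ^ 2 / (4 * ρ ^ 2)) := by
    calc volume.real S * (c * Real.exp (-(1 / 4)))
        = ∫ x in S, c * Real.exp (-(1 / 4)) := by simp
      _ ≤ ∫ x in S, c * Real.exp (-(g x - y) ^ 2 / (4 * ρ ^ 2)) := by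
        refine setIntegral_mono_on ?_ ?_ hSm fun x hx => ?_
        · exact integrableOn_const (measure_ne_top_of_subset inter_subset_left (by simp))
        · exact (hcont.integrableOn_Icc).mono_set inter_subset_left
        · have h2 : (g x - y) ^ 2 ≤ ρ ^ 2 := by
            rw [← sq_abs]; exact pow_le_pow_left₀ (abs_nonneg _) hx.2 2
          gcongr
          rw [neg_div, neg_le_neg_iff, div_le_div_iff₀ (by positivity) (by norm_num)]
          linarith
      _ ≤ _ := setIntegral_mono_set hcont.integrableOn_Icc
          (Eventually.of_forall fun x => by positivity) inter_subset_left.eventuallyLE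
  have hfin := hlow.trans hswap
  have he : Real.exp (-(1 / 4)) * Real.exp (1 / 4) = 1 := by rw [← Real.exp_add]; simp
  have hπ : 0 < √Real.pi := by positivity
  calc volume.real S
      = volume.real S * (c * Real.exp (-(1 / 4))) * (Real.exp (1 / 4) * ρ / √Real.pi) := by
        rw [hc]
        field_simp
        linear_combination -volume.real S * he
    _ ≤ (∫ ξ, ‖G ξ‖) * (Real.exp (1 / 4) * ρ / √Real.pi) := by gcongr
    _ = _ := by ring

/-- The integral over the unit square of a stretched exponential in `|x - z|`. -/
lemma integral_unitSquare_exp_neg_mul_rpow_le {p b : ℝ} (hp : 0 < p) (hb : 0 < b) :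
    ∫ w, Real.exp (-b * |w.1 - w.2| ^ p)
        ∂((volume.restrict (Icc (0 : ℝ) 1)).prod (volume.restrict (Icc (0 : ℝ) 1))) ≤
      2 * (b ^ (-1 / p) * Real.Gamma (1 / p + 1)) := by
  have hcont : Continuous fun w : ℝ × ℝ => Real.exp (-b * |w.1 - w.2| ^ p) :=
    Real.continuous_exp.comp (continuous_const.mul
      ((continuous_fst.sub continuous_snd).abs.rpow_const fun _ => Or.inr hp.le))
  have hval : ∫ u : ℝ, Real.exp (-b * |u| ^ p) = 2 * (b ^ (-1 / p) * Real.Gamma (1 / p + 1)) := by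
    rw [integral_comp_abs (f := fun u => Real.exp (-b * u ^ p)), integral_exp_neg_mul_rpow hp hb]
  have hpos : 0 < 2 * (b ^ (-1 / p) * Real.Gamma (1 / p + 1)) := by
    have := Real.Gamma_pos_of_pos (show 0 < 1 / p + 1 by positivity)
    positivity
  have hint : Integrable fun u : ℝ => Real.exp (-b * |u| ^ p) := by
    by_contra h
    rw [integral_undef h] at hval
    linarith
  have hintw : Integrable (fun w : ℝ × ℝ => Real.exp (-b * |w.1 - w.2| ^ p))
      ((volume.restrict (Icc (0 : ℝ) 1)).prod (volume.restrict (Icc (0 : ℝ) 1))) := by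
    refine (integrable_const (1 : ℝ)).mono' hcont.aestronglyMeasurable
      (Eventually.of_forall fun w => ?_)
    rw [Real.norm_eq_abs, Real.abs_exp, Real.exp_le_one_iff, neg_mul, neg_nonpos]
    positivity
  rw [integral_prod _ hintw]
  calc ∫ x in Icc (0 : ℝ) 1, ∫ z in Icc (0 : ℝ) 1, Real.exp (-b * |x - z| ^ p)
      ≤ ∫ x in Icc (0 : ℝ) 1, 2 * (b ^ (-1 / p) * Real.Gamma (1 / p + 1)) := by
        refine integral_mono_of_nonneg (Eventually.of_forall fun x => by positivity)
          (integrable_const _) (Eventually.of_forall fun x => ?_)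
        simp only
        rw [← hval, ← integral_sub_left_eq_self (fun u => Real.exp (-b * |u| ^ p)) volume x]
        exact setIntegral_le_integral (hint.comp_sub_left x)
          (Eventually.of_forall fun z => by positivity)
    _ = _ := by simp

/-- Gaussian average over `t` of the squared Fourier transform of the occupation measure of
`F + ⟨t, Φ⟩`. -/
lemma integral_gaussian_mul_sq_norm_le {α c : ℝ} (hα : 0 < α) (hc : 0 < c) {d : ℕ}
    {F : ℝ → ℝ} {Φ : ℝ → Fin d → ℝ} (hF : Continuous F) (hΦ : Continuous Φ)
    (hlow : ∀ x ∈ Icc (0 : ℝ) 1, ∀ z ∈ Icc (0 : ℝ) 1, c * |x - z| ^ α ≤ ‖Φ x - Φ z‖)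
    {ξ : ℝ} (hξ : ξ ≠ 0) :
    ∫ t : Fin d → ℝ, Real.exp (-∑ i, t i ^ 2) *
        ‖∫ x in Icc (0 : ℝ) 1, Complex.exp (Complex.I * ξ * (F x + ∑ i, t i * Φ x i : ℝ))‖ ^ 2 ≤
      Real.pi ^ ((d : ℝ) / 2) * (2 * (((c / 2) ^ (-1 / α) * |ξ| ^ (-1 / α)) *
        Real.Gamma (1 / (2 * α) + 1))) := by
  set μ : Measure ℝ := volume.restrict (Icc (0 : ℝ) 1) with hμ
  set D : ℝ × ℝ → Fin d → ℝ := fun w i => Φ w.1 i - Φ w.2 i with hD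
  have hΦi : ∀ i, Continuous fun x => Φ x i := fun i => (continuous_apply i).comp hΦ
  have hsq : ∀ t : Fin d → ℝ, ((‖∫ x, Complex.exp
      (Complex.I * ξ * (F x + ∑ i, t i * Φ x i : ℝ)) ∂μ‖ ^ 2 : ℝ) : ℂ) =
      ∫ w, Complex.exp (Complex.I * ξ * (F w.1 - F w.2 + ∑ i, t i * D w i : ℝ)) ∂(μ.prod μ) := by
    intro t
    rw [Complex.ofReal_pow, ← Complex.mul_conj', ← integral_conj, ← integral_prod_mul]
    refine integral_congr_ae (Eventually.of_forall fun w => ?_)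
    simp only [← Complex.exp_conj, ← Complex.exp_add, map_mul, Complex.conj_I, Complex.conj_ofReal]
    congr 1
    simp only [hD, mul_sub, Finset.sum_sub_distrib]
    push_cast
    ring
  have hint : Integrable (Function.uncurry fun (t : Fin d → ℝ) (w : ℝ × ℝ) =>
      Complex.exp (-(1 : ℂ) * ∑ i, (t i : ℂ) ^ 2 + ∑ i, (Complex.I * ξ * D w i) * (t i : ℂ)) *
        Complex.exp (Complex.I * ξ * (F w.1 - F w.2 : ℝ))) (volume.prod (μ.prod μ)) := by
    have h1 := (GaussianFourier.integrable_cexp_neg_mul_sum_add (b := 1) (by simp)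
      (fun _ : Fin d => (0 : ℂ))).norm.comp_fst (μ.prod μ)
    refine h1.mono' ?_ (Eventually.of_forall fun z => ?_)
    · refine (Continuous.aestronglyMeasurable ?_)
      simp only [hD]
      fun_prop
    · simp only [Function.uncurry, norm_mul, Complex.norm_exp]
      simp [← Complex.ofReal_pow]
  have hre : ((∫ t : Fin d → ℝ, Real.exp (-∑ i, t i ^ 2) * ‖∫ x, Complex.exp
      (Complex.I * ξ * (F x + ∑ i, t i * Φ x i : ℝ)) ∂μ‖ ^ 2 : ℝ) : ℂ) =
      ∫ w, (Real.pi : ℂ) ^ ((d : ℂ) / 2) * Complex.exp ((∑ i, (Complex.I * ξ * D w i) ^ 2) / 4) *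
        Complex.exp (Complex.I * ξ * (F w.1 - F w.2 : ℝ)) ∂(μ.prod μ) := by
    rw [← integral_complex_ofReal]
    calc _ = ∫ t : Fin d → ℝ, ∫ w,
          Complex.exp (-(1 : ℂ) * ∑ i, (t i : ℂ) ^ 2 + ∑ i, (Complex.I * ξ * D w i) * (t i : ℂ)) *
          Complex.exp (Complex.I * ξ * (F w.1 - F w.2 : ℝ)) ∂(μ.prod μ) := by
          refine integral_congr_ae (Eventually.of_forall fun t => ?_)
          simp only
          rw [Complex.ofReal_mul, hsq, ← integral_const_mul]
          refine integral_congr_ae (Eventually.of_forall fun w => ?_)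
          simp only [Complex.ofReal_exp, ← Complex.exp_add]
          congr 1
          push_cast
          rw [mul_add, Finset.mul_sum, neg_one_mul]
          have : ∀ i, Complex.I * ξ * (t i * D w i) = Complex.I * ξ * D w i * t i :=
            fun i => by ring
          simp only [this]
          ring
      _ = _ := by
          rw [integral_integral_swap hint]
          refine integral_congr_ae (Eventually.of_forall fun w => ?_)
          simp only
          rw [integral_mul_const, GaussianFourier.integral_cexp_neg_mul_sum_add (by simp)]
          simp
  have hb : 0 < ξ ^ 2 * c ^ 2 / 4 := by positivity
  have hsupp : ∀ᵐ w ∂(μ.prod μ), w ∈ Icc (0 : ℝ) 1 ×ˢ Icc (0 : ℝ) 1 := by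
    rw [hμ, Measure.prod_restrict]
    exact ae_restrict_mem (measurableSet_Icc.prod measurableSet_Icc)
  have hnorm : ∀ w ∈ Icc (0 : ℝ) 1 ×ˢ Icc (0 : ℝ) 1,
      ‖(Real.pi : ℂ) ^ ((d : ℂ) / 2) * Complex.exp ((∑ i, (Complex.I * ξ * D w i) ^ 2) / 4) *
        Complex.exp (Complex.I * ξ * (F w.1 - F w.2 : ℝ))‖ ≤
      Real.pi ^ ((d : ℝ) / 2) * Real.exp (-(ξ ^ 2 * c ^ 2 / 4) * |w.1 - w.2| ^ (2 * α)) := by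
    intro w hw
    have hDle : ‖Φ w.1 - Φ w.2‖ ^ 2 ≤ ∑ i, D w i ^ 2 := by
      rw [← Real.le_sqrt (norm_nonneg _) (by positivity), pi_norm_le_iff_of_nonneg (by positivity)]
      intro i
      refine Real.le_sqrt_of_sq_le ?_
      rw [Real.norm_eq_abs, sq_abs]
      exact Finset.single_le_sum (f := fun i => D w i ^ 2) (fun j _ => sq_nonneg _)
        (Finset.mem_univ i)
    have hlw : c ^ 2 * |w.1 - w.2| ^ (2 * α) ≤ ∑ i, D w i ^ 2 := by
      refine le_trans ?_ hDle
      rw [mul_comm 2 α, Real.rpow_mul (abs_nonneg _), Real.rpow_two, ← mul_pow]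
      exact pow_le_pow_left₀ (by positivity) (hlow _ hw.1 _ hw.2) 2
    have hexp : (∑ i, (Complex.I * ξ * D w i) ^ 2) / 4 =
        ((-(ξ ^ 2 / 4) * ∑ i, D w i ^ 2 : ℝ) : ℂ) := by
      simp only [mul_pow, Complex.I_sq, ← Finset.mul_sum]
      push_cast
      ring
    have h2 : ‖Complex.exp (Complex.I * ξ * (F w.1 - F w.2 : ℝ))‖ = 1 := by
      rw [Complex.norm_exp]; simp [-Complex.ofReal_sub]
    have h3 : ‖(Real.pi : ℂ) ^ ((d : ℂ) / 2)‖ = Real.pi ^ ((d : ℝ) / 2) := by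
      rw [Complex.norm_cpow_eq_rpow_re_of_pos Real.pi_pos]; simp
    rw [norm_mul, norm_mul, h2, h3, mul_one, hexp, ← Complex.ofReal_exp, Complex.norm_real,
      Real.norm_eq_abs, Real.abs_exp]
    refine mul_le_mul_of_nonneg_left (Real.exp_le_exp.2 ?_) (by positivity)
    nlinarith [mul_le_mul_of_nonneg_left hlw (show 0 ≤ ξ ^ 2 / 4 by positivity)]
  have hpow : (ξ ^ 2 * c ^ 2 / 4) ^ (-1 / (2 * α)) = (c / 2) ^ (-1 / α) * |ξ| ^ (-1 / α) := by
    rw [show ξ ^ 2 * c ^ 2 / 4 = (c / 2 * |ξ|) ^ (2 : ℝ) by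
      rw [Real.rpow_two, mul_pow, sq_abs]; ring, ← Real.rpow_mul (by positivity),
      Real.mul_rpow (by positivity) (by positivity)]
    congr 2 <;> field_simp
  have hcont : Continuous fun w : ℝ × ℝ =>
      Real.pi ^ ((d : ℝ) / 2) * Real.exp (-(ξ ^ 2 * c ^ 2 / 4) * |w.1 - w.2| ^ (2 * α)) :=
    continuous_const.mul (Real.continuous_exp.comp (continuous_const.mul
      ((continuous_fst.sub continuous_snd).abs.rpow_const fun _ => Or.inr (by positivity))))
  have hbd : Integrable (fun w : ℝ × ℝ => Real.pi ^ ((d : ℝ) / 2) *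
      Real.exp (-(ξ ^ 2 * c ^ 2 / 4) * |w.1 - w.2| ^ (2 * α))) (μ.prod μ) := by
    refine (integrable_const (Real.pi ^ ((d : ℝ) / 2))).mono' hcont.aestronglyMeasurable
      (Eventually.of_forall fun w => ?_)
    rw [Real.norm_of_nonneg (by positivity)]
    refine mul_le_of_le_one_right (by positivity) ?_
    rw [Real.exp_le_one_iff, neg_mul, neg_nonpos]
    positivity
  calc _ ≤ ‖((∫ t : Fin d → ℝ, Real.exp (-∑ i, t i ^ 2) * ‖∫ x, Complex.exp
        (Complex.I * ξ * (F x + ∑ i, t i * Φ x i : ℝ)) ∂μ‖ ^ 2 : ℝ) : ℂ)‖ := by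
        rw [Complex.norm_real]; exact le_abs_self _
    _ ≤ ∫ w, Real.pi ^ ((d : ℝ) / 2) *
        Real.exp (-(ξ ^ 2 * c ^ 2 / 4) * |w.1 - w.2| ^ (2 * α)) ∂(μ.prod μ) := by
        rw [hre]
        exact norm_integral_le_of_norm_le hbd (hsupp.mono hnorm)
    _ ≤ _ := by
        rw [integral_const_mul, ← hpow]
        gcongr
        exact integral_unitSquare_exp_neg_mul_rpow_le (by positivity) hb

/-- For almost every `t`, the occupation measure of `F + ⟨t, Φ⟩` has integrable Fourier
transform. -/
lemma ae_integrable_fourier_occupation {α c : ℝ} (hα : 0 < α) (hα2 : α < 1 / 2) (hc : 0 < c)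
    {d : ℕ} {F : ℝ → ℝ} {Φ : ℝ → Fin d → ℝ} (hF : Continuous F) (hΦ : Continuous Φ)
    (hlow : ∀ x ∈ Icc (0 : ℝ) 1, ∀ z ∈ Icc (0 : ℝ) 1, c * |x - z| ^ α ≤ ‖Φ x - Φ z‖) :
    ∀ᵐ t : Fin d → ℝ, Integrable fun ξ : ℝ =>
      ∫ x in Icc (0 : ℝ) 1, Complex.exp (Complex.I * ξ * (F x + ∑ i, t i * Φ x i : ℝ)) := by
  set G : (Fin d → ℝ) → ℝ → ℂ := fun t ξ =>
    ∫ x in Icc (0 : ℝ) 1, Complex.exp (Complex.I * ξ * (F x + ∑ i, t i * Φ x i : ℝ)) with hG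
  have hΦi : ∀ i, Continuous fun x => Φ x i := fun i => (continuous_apply i).comp hΦ
  have hGm : StronglyMeasurable (Function.uncurry G) := by
    refine StronglyMeasurable.integral_prod_right (ν := volume.restrict (Icc (0 : ℝ) 1))
      (f := fun (z : (Fin d → ℝ) × ℝ) (x : ℝ) =>
        Complex.exp (Complex.I * z.2 * (F x + ∑ i, z.1 i * Φ x i : ℝ))) ?_
    refine Continuous.stronglyMeasurable ?_
    simp only [Function.uncurry_def]
    fun_prop
  have hG1 : ∀ t ξ, ‖G t ξ‖ ≤ 1 := by
    intro t ξ
    refine (norm_setIntegral_le_of_norm_le_const (C := 1) (by simp) fun x _ => ?_).trans (by simp)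
    rw [Complex.norm_exp]
    simp [-Complex.ofReal_add]
  set q : ℝ := 1 / α with hq
  set p : ℝ := q / 2 with hp
  have hq2 : 2 < q := by
    rw [hq, lt_div_iff₀ hα]; linarith
  set γ : (Fin d → ℝ) → ℝ := fun t => Real.exp (-∑ i, t i ^ 2) with hγ
  have hγc : Continuous γ := by simp only [hγ]; fun_prop
  have hγi : Integrable γ := by
    have := (GaussianFourier.integrable_cexp_neg_mul_sum_add (b := 1) (by simp)
      (fun _ : Fin d => (0 : ℂ))).norm
    simpa [Complex.norm_exp, ← Complex.ofReal_pow] using this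
  have hγG : ∀ ξ, Integrable fun t => γ t * ‖G t ξ‖ ^ 2 := by
    intro ξ
    have hm : StronglyMeasurable fun t => G t ξ := hGm.comp_measurable measurable_prodMk_right
    refine hγi.mono' (hγc.aestronglyMeasurable.mul (hm.norm.pow 2).aestronglyMeasurable)
      (Eventually.of_forall fun t => ?_)
    rw [Real.norm_of_nonneg (by positivity)]
    exact mul_le_of_le_one_right (Real.exp_pos _).le (pow_le_one₀ (norm_nonneg _) (hG1 t ξ))
  obtain ⟨K, hK0, hK⟩ : ∃ K : ℝ, 0 ≤ K ∧ ∀ ξ : ℝ,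
      ∫ t, γ t * ‖G t ξ‖ ^ 2 ≤ K * (1 + ‖ξ‖) ^ (-q) := by
    set K₁ : ℝ := Real.pi ^ ((d : ℝ) / 2) * (2 * ((c / 2) ^ (-1 / α) *
        Real.Gamma (1 / (2 * α) + 1))) with hK₁
    have hΓ := Real.Gamma_pos_of_pos (show 0 < 1 / (2 * α) + 1 by positivity)
    have hK₁0 : 0 ≤ K₁ := by positivity
    have hγ0 : 0 ≤ ∫ t, γ t := integral_nonneg fun t => (Real.exp_pos _).le
    refine ⟨(K₁ + ∫ t, γ t) * 2 ^ q, by positivity, fun ξ => ?_⟩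
    have h1p : (0 : ℝ) < 1 + ‖ξ‖ := by positivity
    rw [mul_assoc]
    rcases le_or_gt 1 ‖ξ‖ with h | h
    · have hξ : ξ ≠ 0 := by rintro rfl; simp at h; linarith
      have hcmp : |ξ| ^ (-q) ≤ 2 ^ q * (1 + ‖ξ‖) ^ (-q) := by
        rw [Real.rpow_neg (abs_nonneg _), Real.rpow_neg h1p.le, ← div_eq_mul_inv,
          ← Real.div_rpow (by norm_num) h1p.le, ← Real.inv_rpow (abs_nonneg _)]
        refine Real.rpow_le_rpow (by positivity) ?_ (by linarith)
        rw [← Real.norm_eq_abs, inv_eq_one_div, div_le_div_iff₀ (by linarith) h1p]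
        linarith
      calc ∫ t, γ t * ‖G t ξ‖ ^ 2 ≤ K₁ * |ξ| ^ (-q) := by
            refine (integral_gaussian_mul_sq_norm_le hα hc hF hΦ hlow hξ).trans (le_of_eq ?_)
            rw [hK₁, hq, neg_div]
            ring
        _ ≤ (K₁ + ∫ t, γ t) * (2 ^ q * (1 + ‖ξ‖) ^ (-q)) := by gcongr; linarith
    · have hcmp : 1 ≤ 2 ^ q * (1 + ‖ξ‖) ^ (-q) := by
        rw [Real.rpow_neg h1p.le, ← div_eq_mul_inv, ← Real.div_rpow (by norm_num) h1p.le]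
        refine Real.one_le_rpow ?_ (by linarith)
        rw [one_le_div h1p]
        linarith
      calc ∫ t, γ t * ‖G t ξ‖ ^ 2 ≤ ∫ t, γ t :=
            integral_mono (hγG ξ) hγi fun t =>
              mul_le_of_le_one_right (Real.exp_pos _).le (pow_le_one₀ (norm_nonneg _) (hG1 t ξ))
        _ ≤ (K₁ + ∫ t, γ t) * 1 := by linarith
        _ ≤ (K₁ + ∫ t, γ t) * (2 ^ q * (1 + ‖ξ‖) ^ (-q)) := by gcongr
  set H : (Fin d → ℝ) × ℝ → ℝ := fun z => (1 + ‖z.2‖) ^ p * (γ z.1 * ‖G z.1 z.2‖ ^ 2) with hH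
  have hweight : ∀ r : ℝ, Continuous fun ξ : ℝ => (1 + ‖ξ‖) ^ r := fun r =>
    (continuous_const.add continuous_norm).rpow_const fun ξ =>
      Or.inl (show (0 : ℝ) < 1 + ‖ξ‖ by positivity).ne'
  have hHm : StronglyMeasurable H :=
    ((hweight p).comp continuous_snd).stronglyMeasurable.mul
      ((hγc.comp continuous_fst).stronglyMeasurable.mul (hGm.norm.pow 2))
  have hHi : Integrable H (volume.prod volume) := by
    rw [integrable_prod_iff' hHm.aestronglyMeasurable]
    refine ⟨Eventually.of_forall fun ξ => (hγG ξ).const_mul ((1 + ‖ξ‖) ^ p), ?_⟩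
    have hdom : Integrable fun ξ : ℝ => K * (1 + ‖ξ‖) ^ (-p) :=
      (integrable_one_add_norm (by simp; linarith)).const_mul K
    refine hdom.mono' (hHm.norm.integral_prod_left').aestronglyMeasurable
      (Eventually.of_forall fun ξ => ?_)
    have hn : ∀ t, ‖H (t, ξ)‖ = (1 + ‖ξ‖) ^ p * (γ t * ‖G t ξ‖ ^ 2) := fun t =>
      Real.norm_of_nonneg (by positivity)
    rw [Real.norm_of_nonneg (integral_nonneg fun t => norm_nonneg _)]
    simp_rw [hn]
    rw [integral_const_mul]
    calc (1 + ‖ξ‖) ^ p * ∫ t, γ t * ‖G t ξ‖ ^ 2 ≤ (1 + ‖ξ‖) ^ p * (K * (1 + ‖ξ‖) ^ (-q)) := by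
          gcongr; exact hK ξ
      _ = K * (1 + ‖ξ‖) ^ (-p) := by
          rw [mul_left_comm, ← Real.rpow_add (by positivity)]
          congr 2
          rw [hp]; ring
  filter_upwards [hHi.prod_right_ae] with t ht
  have hm : StronglyMeasurable (G t) := hGm.comp_measurable measurable_prodMk_left
  have hdom : Integrable fun ξ : ℝ => (1 + ‖ξ‖) ^ (-p) + (γ t)⁻¹ * H (t, ξ) :=
    (integrable_one_add_norm (by simp; linarith)).add (ht.const_mul _)
  refine hdom.mono' hm.aestronglyMeasurable (Eventually.of_forall fun ξ => ?_)
  have hγt : 0 < γ t := Real.exp_pos _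
  have hA : 0 < (1 + ‖ξ‖) ^ p := by positivity
  rw [hH, Real.rpow_neg (by positivity)]
  simp only
  rw [mul_left_comm (γ t)⁻¹, inv_mul_cancel_left₀ hγt.ne']
  set A := (1 + ‖ξ‖) ^ p
  have hsq : 0 ≤ A * (A⁻¹ - ‖G t ξ‖) ^ 2 := by positivity
  have hexp : A * (A⁻¹ - ‖G t ξ‖) ^ 2 = A⁻¹ - 2 * ‖G t ξ‖ + A * ‖G t ξ‖ ^ 2 := by
    field_simp
    ring
  linarith [norm_nonneg (G t ξ)]

theorem stmt_16 (α C : ℝ) (hα : 0 < α) (hα2 : α < 1/2) (hC : 0 < C)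
    (f : ℝ → ℝ) (hf : ∀ x ∈ Icc (0:ℝ) 1, ∀ z ∈ Icc (0:ℝ) 1, |f x - f z| ≤ C * |x - z| ^ α)
    (d : ℕ) (Φ : ℝ → (Fin d → ℝ)) (c₁ c₂ : ℝ) (hc₁ : 0 < c₁) (hc₂ : 0 < c₂)
    (hΦ : ∀ x ∈ Icc (0:ℝ) 1, ∀ y ∈ Icc (0:ℝ) 1,
      c₁ * |x - y| ^ α ≤ ‖Φ x - Φ y‖ ∧ ‖Φ x - Φ y‖ ≤ c₂ * |x - y| ^ α) :
    ∀ᵐ t : Fin d → ℝ ∂volume, ∀ y : ℝ,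
      upperMinkowski ((fun x => f x + ∑ i, t i * Φ x i) ⁻¹' {y} ∩ Icc (0:ℝ) 1) ≤ 1 - α := by
  have h01 : (0 : ℝ) ≤ 1 := zero_le_one
  have hfc : ContinuousOn f (Icc (0 : ℝ) 1) := continuousOn_of_norm_sub_le_rpow hα hf
  have hΦc : ContinuousOn Φ (Icc (0 : ℝ) 1) :=
    continuousOn_of_norm_sub_le_rpow hα fun x hx z hz => (hΦ x hx z hz).2
  set F : ℝ → ℝ := IccExtend h01 ((Icc (0 : ℝ) 1).domRestrict f)
  set Ψ : ℝ → Fin d → ℝ := IccExtend h01 ((Icc (0 : ℝ) 1).domRestrict Φ)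
  have hFf : ∀ x ∈ Icc (0 : ℝ) 1, F x = f x := fun x hx => IccExtend_of_mem h01 _ hx
  have hΨΦ : ∀ x ∈ Icc (0 : ℝ) 1, Ψ x = Φ x := fun x hx => IccExtend_of_mem h01 _ hx
  have hF : Continuous F := hfc.domRestrict.Icc_extend'
  have hΨ : Continuous Ψ := hΦc.domRestrict.Icc_extend'
  have hΨi : ∀ i, Continuous fun x => Ψ x i := fun i => (continuous_apply i).comp hΨ
  have hlow : ∀ x ∈ Icc (0 : ℝ) 1, ∀ z ∈ Icc (0 : ℝ) 1, c₁ * |x - z| ^ α ≤ ‖Ψ x - Ψ z‖ := by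
    intro x hx z hz
    rw [hΨΦ x hx, hΨΦ z hz]
    exact (hΦ x hx z hz).1
  filter_upwards [ae_integrable_fourier_occupation hα hα2 hc₁ hF hΨ hlow] with t ht y
  obtain ⟨M, hM⟩ := exists_measureReal_sublevel_le (by fun_prop) ht
  set L : ℝ := C + (∑ i, |t i|) * c₂ with hL
  have hL0 : 0 < L := by positivity
  have hgF : ∀ x ∈ Icc (0 : ℝ) 1, F x + ∑ i, t i * Ψ x i = f x + ∑ i, t i * Φ x i := by
    intro x hx
    rw [hFf x hx, hΨΦ x hx]
  have hg : ∀ x ∈ Icc (0 : ℝ) 1, ∀ z ∈ Icc (0 : ℝ) 1,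
      |(f x + ∑ i, t i * Φ x i) - (f z + ∑ i, t i * Φ z i)| ≤ L * |x - z| ^ α := by
    intro x hx z hz
    have hsplit : (f x + ∑ i, t i * Φ x i) - (f z + ∑ i, t i * Φ z i) =
        (f x - f z) + ∑ i, t i * (Φ x - Φ z) i := by
      simp only [Pi.sub_apply, mul_sub, Finset.sum_sub_distrib]
      ring
    have hsum : |∑ i, t i * (Φ x - Φ z) i| ≤ (∑ i, |t i|) * (c₂ * |x - z| ^ α) := by
      rw [Finset.sum_mul]
      refine (Finset.abs_sum_le_sum_abs _ _).trans (Finset.sum_le_sum fun i _ => ?_)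
      rw [abs_mul]
      gcongr
      exact (norm_le_pi_norm (Φ x - Φ z) i).trans (hΦ x hx z hz).2
    rw [hsplit]
    calc _ ≤ C * |x - z| ^ α + (∑ i, |t i|) * (c₂ * |x - z| ^ α) :=
          (abs_add_le _ _).trans (add_le_add (hf x hx z hz) hsum)
      _ = L * |x - z| ^ α := by rw [hL]; ring
  have hM' : ∀ ρ > 0,
      volume.real (Icc (0 : ℝ) 1 ∩ {x | |(f x + ∑ i, t i * Φ x i) - y| ≤ ρ}) ≤ M * ρ := by
    intro ρ hρ
    convert hM y ρ hρ using 2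
    ext x
    refine and_congr_right fun hx => ?_
    change |_| ≤ ρ ↔ |_| ≤ ρ
    rw [hgF x hx]
  refine upperMinkowski_le_of_packingNum_le (le_max_left 1 (M * L)) (by linarith) fun r hr hr2 => ?_
  refine (packingNum_levelSet_le hα hL0 hg hM' hr hr2).trans ?_
  gcongr
  exact le_max_right _ _
end
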